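/- Let a₁, a₂ be polynomials with all zeros on the unit circle such that a₂/a₁ ∈ H^∞ is non-constant. Then there is no analytic φ on the disk with φ·M(\bar{a₁}) = M(\bar{a₂}). -/

import Mathlib

open Complex Set

noncomputable section

/-- The open unit disk in `ℂ`. -/
def unitDisk : Set ℂ := Metric.ball 0 1

/-- The `n`-th Taylor coefficient of `f` at `0`. -/
def coef (f : ℂ → ℂ) (n : ℕ) : ℂ := iteratedDeriv n f 0 / (n.factorial : ℂ)

/-- `f` belongs to the Hardy space `H²` of the unit disk. -/
def MemH2 (f : ℂ → ℂ) : Prop :=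
  DifferentiableOn ℂ f unitDisk ∧ Summable fun n => ‖coef f n‖ ^ 2

/-- The `H²` norm. -/
def norm2 (f : ℂ → ℂ) : ℝ := Real.sqrt (∑' n, ‖coef f n‖ ^ 2)

/-- The `H²` inner product. -/
def inner2 (f g : ℂ → ℂ) : ℂ := ∑' n, coef f n * (starRingEnd ℂ) (coef g n)

/-- `f` belongs to `H^∞`: bounded and analytic on the unit disk. -/
def MemHinf (f : ℂ → ℂ) : Prop :=
  DifferentiableOn ℂ f unitDisk ∧ ∃ C, ∀ z ∈ unitDisk, ‖f z‖ ≤ C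

/-- The `H^∞` (sup) norm. -/
def normInf (f : ℂ → ℂ) : ℝ := sSup ((fun z => ‖f z‖) '' unitDisk)

/-- The co-analytic Toeplitz operator `T_{\bar a}` in terms of Taylor
coefficients: the `n`-th coefficient of `T_{\bar a} f` is
`∑ₖ conj (â k) * f̂ (n + k)`. -/
def Tbar (a f : ℂ → ℂ) : ℂ → ℂ :=
  fun z => ∑' n : ℕ, (∑' k : ℕ, (starRingEnd ℂ) (coef a k) * coef f (n + k)) * z ^ n

/-- Membership in the range space `M(ā) = T_{\bar a} H²` (as functions on the disk). -/
def MemMbar (a g : ℂ → ℂ) : Prop :=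
  ∃ f, MemH2 f ∧ Set.EqOn g (Tbar a f) unitDisk

/-- The range norm on `M(ā)`: `‖T_{\bar a} f‖_{ā} = ‖f‖_{H²}`. -/
def normMbar (a g : ℂ → ℂ) : ℝ :=
  sInf {r | ∃ f, MemH2 f ∧ Set.EqOn g (Tbar a f) unitDisk ∧ r = norm2 f}

/-- `a` is outer: the analytic Toeplitz operator `T_a` (multiplication by `a`)
has dense range in `H²`. -/
def Outer (a : ℂ → ℂ) : Prop :=
  ∀ g, MemH2 g → ∀ ε > 0, ∃ f, MemH2 f ∧ norm2 (fun z => g z - a z * f z) < ε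

/-- `u` is inner: multiplication by `u` is isometric on `H²`. -/
def IsInner (u : ℂ → ℂ) : Prop :=
  MemHinf u ∧ ∀ f, MemH2 f → norm2 (fun z => u z * f z) = norm2 f

/-- `p` is (given by) a polynomial of degree `< N`, i.e. of degree at most `N - 1`. -/
def MemPoly (N : ℕ) (p : ℂ → ℂ) : Prop :=
  ∃ q : Polynomial ℂ, q.degree < (N : WithBot ℕ) ∧ ∀ z, p z = q.eval z

/-- `φ` is a multiplier from `M(ā₁)` to `M(ā₂)`. -/
def Mult (a₁ a₂ φ : ℂ → ℂ) : Prop :=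
  DifferentiableOn ℂ φ unitDisk ∧
    ∀ f, MemMbar a₁ f → MemMbar a₂ fun z => φ z * f z

/-- The backward shift `B f = (f - f 0) / z`. -/
def Bshift (f : ℂ → ℂ) : ℂ → ℂ :=
  fun z => if z = 0 then deriv f 0 else (f z - f 0) / z

open Filter Topology

lemma norm_lt_one_of_mem_unitDisk {z : ℂ} (hz : z ∈ unitDisk) : ‖z‖ < 1 := by
  simpa [unitDisk] using hz

lemma hasFPowerSeriesOnBall_of_hasSum {g : ℂ → ℂ} {u : ℕ → ℂ}
    (h : ∀ z ∈ unitDisk, HasSum (fun n => u n * z ^ n) (g z)) :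
    HasFPowerSeriesOnBall g (FormalMultilinearSeries.ofScalars ℂ u) 0 1 := by
  refine ⟨ENNReal.le_of_forall_nnreal_lt fun r hr => ?_, one_pos, fun {y} hy => ?_⟩
  · have hr' : r < 1 := by exact_mod_cast hr
    have hz : ((r : ℝ) : ℂ) ∈ unitDisk := by simpa [unitDisk] using hr'
    refine FormalMultilinearSeries.le_radius_of_tendsto (l := 0) _ ?_
    have := (h _ hz).summable.tendsto_atTop_zero.norm
    simpa [FormalMultilinearSeries.ofScalars_norm] using this
  · have hy' : y ∈ unitDisk := by simpa [unitDisk, ← enorm_lt_coe, enorm_eq_nnnorm, ← NNReal.coe_lt_coe] using hy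
    simpa [FormalMultilinearSeries.ofScalars_apply_eq, mul_comm] using h y hy'

lemma coef_eq_of_hasSum {g : ℂ → ℂ} {u : ℕ → ℂ}
    (h : ∀ z ∈ unitDisk, HasSum (fun n => u n * z ^ n) (g z)) (n : ℕ) : coef g n = u n := by
  have h1 := (hasFPowerSeriesOnBall_of_hasSum h).factorial_smul 1 n
  rw [coef, iteratedDeriv_eq_iteratedFDeriv, ← h1]
  have : (n.factorial : ℂ) ≠ 0 := by exact_mod_cast n.factorial_ne_zero
  simp
  field_simp

lemma hasSum_coef {g : ℂ → ℂ} (hg : DifferentiableOn ℂ g unitDisk) {z : ℂ} (hz : z ∈ unitDisk) :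
    HasSum (fun n => coef g n * z ^ n) (g z) := by
  have := Complex.hasSum_taylorSeries_on_ball (r := 1) (c := 0) (f := g) (z := z)
    (by simpa [unitDisk] using hg) (by simpa [unitDisk] using hz)
  have e : (fun n => coef g n * z ^ n) =
      fun n : ℕ => (n.factorial : ℂ)⁻¹ • (z - 0) ^ n • iteratedDeriv n g 0 := by
    funext n
    simp only [coef, sub_zero, smul_eq_mul]
    ring
  rw [e]
  exact this

lemma summable_norm_mul_pow {u : ℕ → ℂ} (hu : Summable fun n => ‖u n‖ ^ 2) {z : ℂ}
    (hz : z ∈ unitDisk) : Summable fun n => ‖u n * z ^ n‖ := by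
  have hz := norm_lt_one_of_mem_unitDisk hz
  have h2 : Summable fun n => (‖z‖ ^ 2) ^ n :=
    summable_geometric_of_lt_one (by positivity) (by nlinarith [norm_nonneg z])
  refine Summable.of_nonneg_of_le (fun _ => norm_nonneg _) (fun n => ?_) (hu.add h2)
  rw [norm_mul, norm_pow, ← pow_mul, mul_comm 2 n, pow_mul]
  nlinarith [sq_nonneg (‖u n‖ - ‖z‖ ^ n), norm_nonneg (u n), pow_nonneg (norm_nonneg z) n]

/-- A square-summable sequence is the coefficient sequence of an `H²` function. -/
lemma exists_memH2 {u : ℕ → ℂ} (hu : Summable fun n => ‖u n‖ ^ 2) :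
    ∃ f, MemH2 f ∧ ∀ n, coef f n = u n := by
  have h : ∀ z ∈ unitDisk, HasSum (fun n => u n * z ^ n) ((fun z => ∑' n, u n * z ^ n) z) :=
    fun z hz => (summable_norm_mul_pow hu hz).of_norm.hasSum
  have hc := coef_eq_of_hasSum h
  refine ⟨_, ⟨?_, by simpa only [hc] using hu⟩, hc⟩
  have hball : unitDisk = Metric.eball 0 1 := by
    rw [unitDisk, ← ENNReal.ofReal_one, Metric.eball_ofReal]
  rw [hball]
  exact (hasFPowerSeriesOnBall_of_hasSum h).differentiableOn

lemma coef_polynomial (P : Polynomial ℂ) (n : ℕ) : coef (fun z => P.eval z) n = P.coeff n := by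
  refine coef_eq_of_hasSum (fun z _ => ?_) n
  rw [Polynomial.eval_eq_sum_range]
  refine hasSum_sum_of_ne_finset_zero fun b hb => ?_
  rw [Polynomial.coeff_eq_zero_of_natDegree_lt (by simpa using hb), zero_mul]

/-- The monic polynomial with roots `ζ j`. -/
def rootProd {N : ℕ} (ζ : Fin N → ℂ) : Polynomial ℂ := ∏ j, (Polynomial.X - Polynomial.C (ζ j))

lemma eval_rootProd {N : ℕ} (ζ : Fin N → ℂ) (z : ℂ) : (rootProd ζ).eval z = ∏ j, (z - ζ j) := by
  simp [rootProd, Polynomial.eval_prod]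

lemma natDegree_rootProd {N : ℕ} (ζ : Fin N → ℂ) : (rootProd ζ).natDegree = N := by
  simp [rootProd]

open Polynomial in
lemma exists_map_conj_prod_eq {ι : Type*} (s : Finset ι) (ζ : ι → ℂ) (hζ : ∀ j, ‖ζ j‖ = 1) :
    ∃ c : ℂ, c ≠ 0 ∧ (∏ j ∈ s, (X - C (ζ j))).map (starRingEnd ℂ) =
      C c * reflect s.card (∏ j ∈ s, (X - C (ζ j))) := by
  classical
  induction s using Finset.induction_on with
  | empty => exact ⟨1, one_ne_zero, by simp⟩
  | insert i s hi ih =>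
    obtain ⟨c, hc, h⟩ := ih
    have h0 : ζ i ≠ 0 := by rw [← norm_ne_zero_iff, hζ]; exact one_ne_zero
    have h1 : (starRingEnd ℂ) (ζ i) * ζ i = 1 := by
      rw [mul_comm, Complex.mul_conj, Complex.normSq_eq_norm_sq, hζ]; simp
    refine ⟨-(starRingEnd ℂ) (ζ i) * c, mul_ne_zero (by simpa using h0) hc, ?_⟩
    rw [Finset.prod_insert hi, Finset.card_insert_of_notMem hi, Polynomial.map_mul, h, add_comm,
      reflect_mul _ _ (by simp) (by simp)]
    have : reflect 1 (X - C (ζ i)) = 1 - C (ζ i) * X := by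
      rw [reflect_sub, reflect_one_X, reflect_C, pow_one]
    rw [this]
    have h2 : C ((starRingEnd ℂ) (ζ i)) * C (ζ i) = (1 : ℂ[X]) := by rw [← C_mul, h1, C_1]
    simp only [Polynomial.map_sub, map_X, map_C, C_mul, C_neg]
    linear_combination (-X * C c * reflect s.card (∏ j ∈ s, (X - C (ζ j)))) * h2

/-- On the unit circle `conj a = c * z⁻ᴺ * a`; this is its effect on coefficients. -/
lemma exists_conj_coeff_rootProd {N : ℕ} (ζ : Fin N → ℂ) (hζ : ∀ j, ‖ζ j‖ = 1) :
    ∃ c : ℂ, c ≠ 0 ∧ ∀ k ≤ N,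
      (starRingEnd ℂ) ((rootProd ζ).coeff k) = c * (rootProd ζ).coeff (N - k) := by
  obtain ⟨c, hc, h⟩ := exists_map_conj_prod_eq Finset.univ ζ hζ
  refine ⟨c, hc, fun k hk => ?_⟩
  have := congrArg (fun P => P.coeff k) h
  simpa [rootProd, Polynomial.coeff_map, Polynomial.coeff_reflect, Polynomial.revAt_le hk] using this

/-- The Taylor coefficients of `T_{\bar a} f` are, up to a constant, those of `a f`
shifted by the degree of `a`. -/
lemma exists_tsum_conj_coef_rootProd {N : ℕ} (ζ : Fin N → ℂ) (hζ : ∀ j, ‖ζ j‖ = 1) :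
    ∃ c : ℂ, c ≠ 0 ∧ ∀ (u : ℕ → ℂ) (n : ℕ),
      ∑' k, (starRingEnd ℂ) (coef (fun z => ∏ j, (z - ζ j)) k) * u (n + k) =
        c * PowerSeries.coeff (n + N) ((rootProd ζ : PowerSeries ℂ) * PowerSeries.mk u) := by
  obtain ⟨c, hc, h⟩ := exists_conj_coeff_rootProd ζ hζ
  refine ⟨c, hc, fun u n => ?_⟩
  have hz : ∀ k, N < k → (rootProd ζ).coeff k = 0 := fun k hk =>
    Polynomial.coeff_eq_zero_of_natDegree_lt (by rwa [natDegree_rootProd])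
  simp only [← eval_rootProd, coef_polynomial]
  rw [tsum_eq_sum (s := Finset.range (N + 1))
    (fun k hk => by rw [hz k (by simpa using hk)]; simp),
    PowerSeries.coeff_mul, Finset.Nat.sum_antidiagonal_eq_sum_range_succ_mk,
    ← Finset.sum_range_reflect, Finset.mul_sum]
  have hsub : Finset.range (N + 1) ⊆ Finset.range (n + N).succ := Finset.range_mono (by omega)
  rw [← Finset.sum_subset hsub (fun k _ hk => by
    simp [Polynomial.coeff_coe, hz k (by simpa using hk)])]
  refine Finset.sum_congr rfl fun k hk => ?_
  have hk : k ≤ N := by simpa [Nat.lt_succ_iff] using hk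
  rw [show N + 1 - 1 - k = N - k by omega, h _ (Nat.sub_le _ _), Nat.sub_sub_self hk]
  simp only [Polynomial.coeff_coe, PowerSeries.coeff_mk]
  rw [show n + (N - k) = n + N - k by omega, mul_assoc]

lemma hasSum_polynomial_mul (P : Polynomial ℂ) {F : PowerSeries ℂ} {z s : ℂ}
    (h : HasSum (fun n => PowerSeries.coeff n F * z ^ n) s) :
    HasSum (fun n => PowerSeries.coeff n ((P : PowerSeries ℂ) * F) * z ^ n) (P.eval z * s) := by
  induction P using Polynomial.induction_on' with
  | add p q hp hq =>
    simpa [add_mul] using hp.add hq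
  | monomial m a =>
    rw [← hasSum_nat_add_iff' m]
    have h0 : ∑ i ∈ Finset.range m, PowerSeries.coeff i
        (((Polynomial.monomial m a : Polynomial ℂ) : PowerSeries ℂ) * F) * z ^ i = 0 := by
      refine Finset.sum_eq_zero fun i hi => ?_
      have hi : i < m := by simpa using hi
      rw [← Polynomial.C_mul_X_pow_eq_monomial]
      simp [mul_assoc, PowerSeries.coeff_C_mul, PowerSeries.coeff_X_pow_mul', hi.not_ge]
    rw [h0, sub_zero]
    rw [Polynomial.eval_monomial]
    have e : (fun n => PowerSeries.coeff (n + m)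
        (((Polynomial.monomial m a : Polynomial ℂ) : PowerSeries ℂ) * F) * z ^ (n + m)) =
        fun n => a * z ^ m * (PowerSeries.coeff n F * z ^ n) := by
      funext n
      rw [← Polynomial.C_mul_X_pow_eq_monomial]
      simp [mul_assoc, PowerSeries.coeff_C_mul, PowerSeries.coeff_X_pow_mul', pow_add]
      left
      ring
    rw [e]
    exact h.mul_left (a * z ^ m)

lemma MemMbar.exists_eq {N : ℕ} {ζ : Fin N → ℂ} (hζ : ∀ j, ‖ζ j‖ = 1) {g : ℂ → ℂ}
    (hg : MemMbar (fun z => ∏ j, (z - ζ j)) g) :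
    ∃ (f : ℂ → ℂ) (c : ℂ) (p : Polynomial ℂ), MemH2 f ∧ ∀ z ∈ unitDisk,
      z ^ N * g z = c * ((rootProd ζ).eval z * f z) - p.eval z := by
  obtain ⟨f, hf, hgf⟩ := hg
  obtain ⟨c, -, h⟩ := exists_tsum_conj_coef_rootProd ζ hζ
  set G : PowerSeries ℂ := (rootProd ζ : PowerSeries ℂ) * PowerSeries.mk (coef f) with hG
  refine ⟨f, c, Polynomial.C c * ∑ i ∈ Finset.range N,
    Polynomial.C (PowerSeries.coeff i G) * Polynomial.X ^ i, hf, fun z hz => ?_⟩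
  have h1 : HasSum (fun n => PowerSeries.coeff n G * z ^ n) ((rootProd ζ).eval z * f z) :=
    hasSum_polynomial_mul _ (by simpa using hasSum_coef hf.1 hz)
  have h2 := ((hasSum_nat_add_iff' N).2 h1).mul_left c
  rw [hgf hz, Tbar, ← tsum_mul_left]
  simp only [h, ← hG]
  have e : ∀ n, z ^ N * (c * PowerSeries.coeff (n + N) G * z ^ n) =
      c * (PowerSeries.coeff (n + N) G * z ^ (n + N)) := fun n => by ring
  simp only [e]
  rw [h2.tsum_eq]
  simp [Polynomial.eval_finsetSum, mul_sub]

lemma memMbar_mul {N : ℕ} {ζ : Fin N → ℂ} (hζ : ∀ j, ‖ζ j‖ = 1) {h : ℂ → ℂ} (hh : MemH2 h) :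
    MemMbar (fun z => ∏ j, (z - ζ j)) fun z => (∏ j, (z - ζ j)) * h z := by
  obtain ⟨c, hc, hcoef⟩ := exists_tsum_conj_coef_rootProd ζ hζ
  have hs : Summable fun n => ‖c⁻¹ * (if n < N then 0 else coef h (n - N))‖ ^ 2 := by
    refine (summable_nat_add_iff N).1 ((hh.2.mul_left (‖c‖⁻¹ ^ 2)).congr fun n => ?_)
    rw [if_neg (by omega), Nat.add_sub_cancel, norm_mul, norm_inv, mul_pow]
  obtain ⟨f, hf, hfc⟩ := exists_memH2 hs
  refine ⟨f, hf, fun z hz => ?_⟩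
  have hmk : PowerSeries.mk (coef f) =
      PowerSeries.X ^ N * (PowerSeries.C c⁻¹ * PowerSeries.mk (coef h)) := by
    ext n
    rw [PowerSeries.coeff_X_pow_mul', PowerSeries.coeff_mk, hfc]
    by_cases hn : n < N
    · simp [hn, hn.not_ge]
    · simp [hn, not_lt.1 hn, PowerSeries.coeff_C_mul]
  have e : ∀ n, c * PowerSeries.coeff (n + N)
      ((rootProd ζ : PowerSeries ℂ) * PowerSeries.mk (coef f)) =
      PowerSeries.coeff n ((rootProd ζ : PowerSeries ℂ) * PowerSeries.mk (coef h)) := fun n => by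
    rw [hmk, mul_left_comm, mul_left_comm _ (PowerSeries.C c⁻¹), PowerSeries.coeff_X_pow_mul',
      if_pos (Nat.le_add_left _ _), Nat.add_sub_cancel, PowerSeries.coeff_C_mul,
      mul_inv_cancel_left₀ hc]
  simp only [Tbar, hcoef, e]
  rw [← eval_rootProd]
  exact (hasSum_polynomial_mul _ (by simpa using hasSum_coef hh.1 hz)).tsum_eq.symm

lemma memMbar_one {N : ℕ} {ζ : Fin N → ℂ} (hζ : ∀ j, ‖ζ j‖ = 1) :
    MemMbar (fun z => ∏ j, (z - ζ j)) fun _ => 1 := by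
  have h0 : (starRingEnd ℂ) ((rootProd ζ).coeff 0) ≠ 0 := by
    rw [Polynomial.coeff_zero_eq_eval_zero, eval_rootProd, map_ne_zero, Finset.prod_ne_zero_iff]
    intro j _
    rw [zero_sub, neg_ne_zero, ← norm_ne_zero_iff, hζ]
    exact one_ne_zero
  set d := ((starRingEnd ℂ) ((rootProd ζ).coeff 0))⁻¹
  have hd : ∀ n, coef (fun _ => d) n = if n = 0 then d else 0 := fun n => by
    simpa [Polynomial.coeff_C] using coef_polynomial (Polynomial.C d) n
  refine ⟨fun _ => d, ⟨differentiableOn_const _, ?_⟩, fun z _ => ?_⟩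
  · refine summable_of_ne_finset_zero (s := {0}) fun n hn => ?_
    rw [hd, if_neg (by simpa using hn)]
    simp
  · simp only [Tbar, ← eval_rootProd, coef_polynomial]
    rw [tsum_eq_single 0, tsum_eq_single 0]
    · simp [hd, d, mul_inv_cancel₀ h0]
    · intro n hn
      simp [hd, hn]
    · intro n hn
      simp [hd, hn]

lemma eventually_mul_mem_unitDisk {ζ : ℂ} (hζ : ‖ζ‖ = 1) :
    ∀ᶠ r : ℝ in 𝓝[<] 1, (r : ℂ) * ζ ∈ unitDisk ∧ 0 < r ∧ r < 1 := by
  filter_upwards [Ioo_mem_nhdsLT (show (0 : ℝ) < 1 by norm_num)] with r hr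
  exact ⟨by simpa [unitDisk, hζ, abs_of_pos hr.1] using hr.2, hr⟩

lemma tendsto_radial (P : Polynomial ℂ) (ζ : ℂ) :
    Tendsto (fun r : ℝ => P.eval ((r : ℂ) * ζ)) (𝓝[<] 1) (𝓝 (P.eval ζ)) := by
  have : Continuous fun r : ℝ => P.eval ((r : ℂ) * ζ) := by fun_prop
  simpa using (this.tendsto 1).mono_left nhdsWithin_le_nhds

lemma tendsto_sqrt_one_sub :
    Tendsto (fun r : ℝ => ((√(1 - r) : ℝ) : ℂ)) (𝓝[<] 1) (𝓝 0) := by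
  have : Continuous fun r : ℝ => ((√(1 - r) : ℝ) : ℂ) := by fun_prop
  simpa using (this.tendsto 1).mono_left nhdsWithin_le_nhds

/-- Radial growth of `H²` functions. -/
lemma MemH2.tendsto_sqrt_mul {f : ℂ → ℂ} (hf : MemH2 f) {ζ : ℂ} (hζ : ‖ζ‖ = 1) :
    Tendsto (fun r : ℝ => ((√(1 - r) : ℝ) : ℂ) * f (r * ζ)) (𝓝[<] 1) (𝓝 0) := by
  rw [Metric.tendsto_nhds]
  intro δ hδ
  set ε := δ / 2 with hε
  have hε0 : 0 < ε := by positivity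
  obtain ⟨M, hM⟩ := ((tendsto_sum_nat_add fun n => ‖coef f n‖ ^ 2).eventually
    (gt_mem_nhds (show 0 < ε ^ 2 by positivity))).exists
  have hpoly : Tendsto (fun r : ℝ => ((√(1 - r) : ℝ) : ℂ) *
      ∑ n ∈ Finset.range M, coef f n * ((r : ℂ) * ζ) ^ n) (𝓝[<] 1) (𝓝 0) := by
    have : Continuous fun r : ℝ => ((√(1 - r) : ℝ) : ℂ) *
      ∑ n ∈ Finset.range M, coef f n * ((r : ℂ) * ζ) ^ n := by fun_prop
    simpa using (this.tendsto 1).mono_left nhdsWithin_le_nhds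
  filter_upwards [eventually_mul_mem_unitDisk hζ, (Metric.tendsto_nhds.1 hpoly) ε hε0]
    with r ⟨hz, hr0, hr1⟩ hp
  rw [dist_zero_right] at hp ⊢
  have hs := hasSum_coef hf.1 hz
  rw [← hs.tsum_eq, ← hs.summable.sum_add_tsum_nat_add M, mul_add]
  refine (norm_add_le _ _).trans_lt ?_
  suffices ‖((√(1 - r) : ℝ) : ℂ) * ∑' n, coef f (n + M) * ((r : ℂ) * ζ) ^ (n + M)‖ ≤ ε by
    linarith
  have hb : HasSum (fun n => ‖coef f (n + M)‖ ^ 2 / (2 * ε) + ε / 2 * ((1 - r) * r ^ n))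
      ((∑' n, ‖coef f (n + M)‖ ^ 2) / (2 * ε) + ε / 2 * ((1 - r) * (1 - r)⁻¹)) :=
    (((summable_nat_add_iff M).2 hf.2).hasSum.div_const _).add
      (((hasSum_geometric_of_lt_one hr0.le hr1).mul_left _).mul_left _)
  rw [← tsum_mul_left]
  refine (tsum_of_norm_bounded hb fun n => ?_).trans ?_
  · have hpow : r ^ (n + M) * r ^ (n + M) ≤ r ^ n := by
      rw [← pow_add]
      exact pow_le_pow_of_le_one hr0.le hr1.le (by omega)
    have hsq : √(1 - r) * √(1 - r) = 1 - r := Real.mul_self_sqrt (by linarith)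
    have hy : (√(1 - r) * r ^ (n + M)) ^ 2 ≤ (1 - r) * r ^ n := by
      calc (√(1 - r) * r ^ (n + M)) ^ 2
          = (√(1 - r) * √(1 - r)) * (r ^ (n + M) * r ^ (n + M)) := by ring
        _ ≤ (1 - r) * r ^ n := by
          rw [hsq]; exact mul_le_mul_of_nonneg_left hpow (by linarith)
    simp only [norm_mul, norm_pow, hζ, mul_one, Complex.norm_real, Real.norm_eq_abs,
      abs_of_pos hr0, abs_of_nonneg (Real.sqrt_nonneg _)]
    set x := ‖coef f (n + M)‖
    set y := √(1 - r) * r ^ (n + M) with hy'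
    have : √(1 - r) * (x * r ^ (n + M)) ≤ x ^ 2 / (2 * ε) + ε / 2 * y ^ 2 := by
      have : x ^ 2 / (2 * ε) + ε / 2 * y ^ 2 - x * y = (x - ε * y) ^ 2 / (2 * ε) := by
        field_simp; ring
      have h0 : 0 ≤ (x - ε * y) ^ 2 / (2 * ε) := by positivity
      have : √(1 - r) * (x * r ^ (n + M)) = x * y := by rw [hy']; ring
      linarith
    nlinarith
  · rw [mul_inv_cancel₀ (by linarith)]
    have : (∑' n, ‖coef f (n + M)‖ ^ 2) / (2 * ε) ≤ ε ^ 2 / (2 * ε) := by gcongr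
    have : ε ^ 2 / (2 * ε) = ε / 2 := by field_simp
    linarith

/-- A polynomial vanishing at `ζ` improves radial growth there by a factor `o(1 - r)`. -/
lemma tendsto_mul_div_sqrt {P : Polynomial ℂ} {ζ : ℂ} (h : P.eval ζ = 0) {F : ℝ → ℂ}
    (hF : Tendsto (fun r : ℝ => ((√(1 - r) : ℝ) : ℂ) * F r) (𝓝[<] 1) (𝓝 0)) :
    Tendsto (fun r : ℝ => P.eval ((r : ℂ) * ζ) * F r / ((√(1 - r) : ℝ) : ℂ))
      (𝓝[<] 1) (𝓝 0) := by
  obtain ⟨Q, rfl⟩ := Polynomial.dvd_iff_isRoot.2 h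
  have h1 := (hF.mul_const (-ζ)).mul (tendsto_radial Q ζ)
  rw [zero_mul, zero_mul] at h1
  refine h1.congr' ?_
  filter_upwards [self_mem_nhdsWithin] with r hr
  have hr : 0 < 1 - r := sub_pos.2 hr
  have h0 : ((√(1 - r) : ℝ) : ℂ) ≠ 0 := by exact_mod_cast (Real.sqrt_pos.2 hr).ne'
  have hsq : ((√(1 - r) : ℝ) : ℂ) * ((√(1 - r) : ℝ) : ℂ) = 1 - r := by
    exact_mod_cast Real.mul_self_sqrt hr.le
  rw [eq_div_iff h0]
  simp only [Polynomial.eval_mul, Polynomial.eval_sub, Polynomial.eval_X, Polynomial.eval_C]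
  linear_combination (-ζ * Q.eval (r * ζ) * F r) * hsq

lemma tendsto_div_sqrt {P : Polynomial ℂ} {ζ : ℂ} (h : P.eval ζ = 0) :
    Tendsto (fun r : ℝ => P.eval ((r : ℂ) * ζ) / ((√(1 - r) : ℝ) : ℂ)) (𝓝[<] 1) (𝓝 0) := by
  simpa using tendsto_mul_div_sqrt h (F := fun _ => 1) (by simpa using tendsto_sqrt_one_sub)

/-- A rational function that is radially `o(1 / √(1 - r))` has a radial limit. -/
lemma exists_tendsto_div {ζ : ℂ} (hζ : ‖ζ‖ = 1) (q a : Polynomial ℂ)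
    (ha : ∀ z ∈ unitDisk, a.eval z ≠ 0)
    (h : Tendsto (fun r : ℝ => ((√(1 - r) : ℝ) : ℂ) *
      (q.eval ((r : ℂ) * ζ) / a.eval ((r : ℂ) * ζ))) (𝓝[<] 1) (𝓝 0)) :
    ∃ L, Tendsto (fun r : ℝ => q.eval ((r : ℂ) * ζ) / a.eval ((r : ℂ) * ζ)) (𝓝[<] 1) (𝓝 L) := by
  induction hn : a.natDegree generalizing a q with
  | zero =>
    by_cases haζ : a.eval ζ = 0
    · rw [Polynomial.eq_C_of_natDegree_eq_zero hn] at ha haζ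
      exact absurd haζ (by simpa using ha 0 (by simp [unitDisk]))
    · exact ⟨_, (tendsto_radial q ζ).div (tendsto_radial a ζ) haζ⟩
  | succ n ih =>
    by_cases haζ : a.eval ζ = 0
    · have hqζ : q.eval ζ = 0 := by
        have h1 := h.mul (tendsto_div_sqrt haζ)
        rw [zero_mul] at h1
        refine tendsto_nhds_unique (tendsto_radial q ζ) (h1.congr' ?_)
        filter_upwards [eventually_mul_mem_unitDisk hζ] with r ⟨hz, _, hr⟩
        have h0 : ((√(1 - r) : ℝ) : ℂ) ≠ 0 := by
          exact_mod_cast (Real.sqrt_pos.2 (sub_pos.2 hr)).ne'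
        have := ha _ hz
        field_simp
      obtain ⟨b, rfl⟩ := Polynomial.dvd_iff_isRoot.2 haζ
      obtain ⟨p, rfl⟩ := Polynomial.dvd_iff_isRoot.2 hqζ
      have hb : ∀ z ∈ unitDisk, b.eval z ≠ 0 := fun z hz hb => ha z hz (by simp [hb])
      have e : ∀ᶠ r : ℝ in 𝓝[<] 1,
          ((Polynomial.X - Polynomial.C ζ) * p).eval ((r : ℂ) * ζ) /
            ((Polynomial.X - Polynomial.C ζ) * b).eval ((r : ℂ) * ζ) =
          p.eval ((r : ℂ) * ζ) / b.eval ((r : ℂ) * ζ) := by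
        filter_upwards [eventually_mul_mem_unitDisk hζ] with r ⟨hz, _, _⟩
        have h1 := ha _ hz
        rw [Polynomial.eval_mul] at h1
        rw [Polynomial.eval_mul, Polynomial.eval_mul,
          mul_div_mul_left _ _ (left_ne_zero_of_mul h1)]
      have hb0 : b ≠ 0 := by
        rintro rfl
        exact hb 0 (by simp [unitDisk]) (by simp)
      obtain ⟨L, hL⟩ := ih p b hb (h.congr' (by filter_upwards [e] with r hr; rw [hr])) (by
        rw [Polynomial.natDegree_mul (Polynomial.X_sub_C_ne_zero _) hb0,
          Polynomial.natDegree_X_sub_C] at hn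
        omega)
      exact ⟨L, hL.congr' (by filter_upwards [e] with r hr; rw [hr])⟩
    · exact ⟨_, (tendsto_radial q ζ).div (tendsto_radial a ζ) haζ⟩

open Polynomial in
lemma prod_dvd_of_bounded {ι : Type*} (s : Finset ι) (ζ : ι → ℂ) (hζ : ∀ j, ‖ζ j‖ = 1)
    {k : ℂ → ℂ} {M : ℝ} (hk : ∀ z ∈ unitDisk, ‖k z‖ ≤ M) (P : ℂ[X])
    (hP : ∀ z ∈ unitDisk, P.eval z = (∏ j ∈ s, (z - ζ j)) * k z) :
    ∏ j ∈ s, (X - C (ζ j)) ∣ P := by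
  classical
  induction s using Finset.induction_on generalizing P with
  | empty => simp
  | insert i s hi ih =>
    have hroot : P.eval (ζ i) = 0 := by
      have h1 := tendsto_radial (∏ j ∈ insert i s, (X - C (ζ j))) (ζ i)
      have h0 : Polynomial.eval (ζ i) (∏ j ∈ insert i s, (X - C (ζ j))) = 0 := by
        simp [eval_prod, Finset.prod_insert hi]
      rw [h0] at h1
      have h2 : IsBoundedUnder (· ≤ ·) (𝓝[<] 1) (norm ∘ fun r : ℝ => k ((r : ℂ) * ζ i)) :=
        isBoundedUnder_of_eventually_le (a := M) (by
          filter_upwards [eventually_mul_mem_unitDisk (hζ i)] with r hr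
          exact hk _ hr.1)
      refine tendsto_nhds_unique (tendsto_radial P (ζ i))
        ((h1.zero_mul_isBoundedUnder_le h2).congr' ?_)
      filter_upwards [eventually_mul_mem_unitDisk (hζ i)] with r hr
      simp only [hP _ hr.1, eval_prod, eval_sub, eval_X, eval_C]
    obtain ⟨Q, rfl⟩ := dvd_iff_isRoot.2 hroot
    rw [Finset.prod_insert hi]
    refine mul_dvd_mul_left _ (ih Q fun z hz => ?_)
    have hne : z - ζ i ≠ 0 := fun h => by
      have := norm_lt_one_of_mem_unitDisk hz
      rw [sub_eq_zero.1 h, hζ] at this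
      exact lt_irrefl _ this
    have := hP z hz
    rw [Finset.prod_insert hi, eval_mul, mul_assoc] at this
    exact mul_left_cancel₀ hne (by simpa using this)

/-- The logarithmic `H²` function `∑ (conj ζ * z)ⁿ / (n + 1)` has no radial limit at `ζ`. -/
lemma exists_memH2_not_tendsto {ζ : ℂ} (hζ : ‖ζ‖ = 1) :
    ∃ h, MemH2 h ∧ ∀ L, ¬ Tendsto (fun r : ℝ => h ((r : ℂ) * ζ)) (𝓝[<] 1) (𝓝 L) := by
  have hs : Summable fun n : ℕ => ‖(starRingEnd ℂ) ζ ^ n / ((n : ℂ) + 1)‖ ^ 2 := by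
    have h := (summable_nat_add_iff 1).2 (Real.summable_one_div_nat_pow.2 one_lt_two)
    refine h.congr fun n => ?_
    have : ‖(n : ℂ) + 1‖ = n + 1 := by exact_mod_cast Complex.norm_natCast (n + 1)
    simp [this, hζ]
  obtain ⟨h, hh, hc⟩ := exists_memH2 hs
  refine ⟨h, hh, fun L hL => ?_⟩
  have hζ1 : ζ * (starRingEnd ℂ) ζ = 1 := by
    rw [Complex.mul_conj, Complex.normSq_eq_norm_sq, hζ]; simp
  have e : ∀ᶠ r : ℝ in 𝓝[<] 1, (r : ℂ) * h ((r : ℂ) * ζ) = ((-Real.log (1 - r) : ℝ) : ℂ) := by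
    filter_upwards [eventually_mul_mem_unitDisk hζ] with r ⟨hz, hr0, hr1⟩
    have h1 := (hasSum_coef hh.1 hz).mul_left (r : ℂ)
    have h2 := Complex.hasSum_ofReal.2
      (Real.hasSum_pow_div_log_of_abs_lt_one (x := r) (by rw [abs_of_pos hr0]; exact hr1))
    have e : (fun n => (r : ℂ) * (coef h n * ((r : ℂ) * ζ) ^ n)) =
        fun n : ℕ => ((r ^ (n + 1) / (n + 1) : ℝ) : ℂ) := by
      funext n
      rw [hc, mul_pow]
      push_cast
      have hp : ζ ^ n * (starRingEnd ℂ) ζ ^ n = 1 := by rw [← mul_pow, hζ1, one_pow]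
      linear_combination (r * r ^ n / ((n : ℂ) + 1)) * hp
    rw [e] at h1
    exact h1.unique h2
  have h1 : Tendsto (fun r : ℝ => ‖(r : ℂ) * h ((r : ℂ) * ζ)‖) (𝓝[<] 1) atTop := by
    have hg : Tendsto (fun r : ℝ => 1 - r) (𝓝[<] 1) (𝓝[>] 0) := by
      refine tendsto_nhdsWithin_iff.2 ⟨?_, ?_⟩
      · have : Continuous fun r : ℝ => 1 - r := by fun_prop
        simpa using (this.tendsto 1).mono_left nhdsWithin_le_nhds
      · filter_upwards [self_mem_nhdsWithin] with r hr
        exact mem_Ioi.2 (sub_pos.2 (mem_Iio.1 hr))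
    have h3 := (tendsto_abs_atBot_atTop.comp Real.tendsto_log_nhdsGT_zero).comp hg
    refine h3.congr' ?_
    filter_upwards [e] with r hr
    rw [hr, Complex.norm_real]
    simp
  have h2 : Tendsto (fun r : ℝ => (r : ℂ)) (𝓝[<] 1) (𝓝 1) := by
    simpa using (Complex.continuous_ofReal.tendsto 1).mono_left nhdsWithin_le_nhds
  exact not_tendsto_atTop_of_tendsto_nhds (h2.mul hL).norm h1

/-- for polynomials `a₁, a₂` with all zeros on the unit circle
such that `a₂/a₁ ∈ H^∞` is non-constant, there is no analytic `φ` on the disk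
with `φ·M(ā₁) = M(ā₂)`. -/
theorem stmt13 (N₁ N₂ : ℕ) (ζ₁ : Fin N₁ → ℂ) (ζ₂ : Fin N₂ → ℂ)
    (hζ₁ : ∀ j, ‖ζ₁ j‖ = 1) (hζ₂ : ∀ j, ‖ζ₂ j‖ = 1)
    (k : ℂ → ℂ) (hk : MemHinf k)
    (hdiv : ∀ z ∈ unitDisk, (∏ j, (z - ζ₂ j)) = (∏ j, (z - ζ₁ j)) * k z)
    (hnc : ¬ ∃ c : ℂ, ∀ z ∈ unitDisk, k z = c) :
    ¬ ∃ φ : ℂ → ℂ, DifferentiableOn ℂ φ unitDisk ∧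
      (∀ f, MemMbar (fun z => ∏ j, (z - ζ₁ j)) f →
        MemMbar (fun z => ∏ j, (z - ζ₂ j)) fun z => φ z * f z) ∧
      ∀ g, MemMbar (fun z => ∏ j, (z - ζ₂ j)) g →
        ∃ f, MemMbar (fun z => ∏ j, (z - ζ₁ j)) f ∧
          ∀ z ∈ unitDisk, g z = φ z * f z := by
  have hA₁ : ∀ z ∈ unitDisk, (rootProd ζ₁).eval z ≠ 0 := fun z hz h => by
    rw [eval_rootProd, Finset.prod_eq_zero_iff] at h
    obtain ⟨j, -, hj⟩ := h
    have := norm_lt_one_of_mem_unitDisk hz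
    rw [sub_eq_zero.1 hj, hζ₁] at this
    exact lt_irrefl _ this
  obtain ⟨M, hM⟩ := hk.2
  obtain ⟨K, hK⟩ : rootProd ζ₁ ∣ rootProd ζ₂ :=
    prod_dvd_of_bounded Finset.univ ζ₁ hζ₁ hM _ fun z hz => by rw [eval_rootProd, hdiv z hz]
  have hKk : ∀ z ∈ unitDisk, k z = K.eval z := fun z hz => by
    have h := hdiv z hz
    rw [← eval_rootProd, ← eval_rootProd, hK, Polynomial.eval_mul] at h
    exact (mul_left_cancel₀ (hA₁ z hz) h).symm
  obtain ⟨ζ, hKζ⟩ : ∃ ζ, K.eval ζ = 0 := by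
    refine Complex.exists_root (not_le.1 fun hdeg => hnc ⟨K.coeff 0, fun z hz => ?_⟩)
    rw [hKk z hz, Polynomial.eq_C_of_degree_le_zero hdeg]
    simp
  have hA₂ζ : (rootProd ζ₂).eval ζ = 0 := by rw [hK, Polynomial.eval_mul, hKζ, mul_zero]
  have hζ : ‖ζ‖ = 1 := by
    have h := hA₂ζ
    rw [eval_rootProd, Finset.prod_eq_zero_iff] at h
    obtain ⟨j, -, hj⟩ := h
    rw [sub_eq_zero.1 hj, hζ₂]
  have hsqrt : ∀ r : ℝ, r < 1 → ((√(1 - r) : ℝ) : ℂ) ≠ 0 := fun r hr => by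
    exact_mod_cast (Real.sqrt_pos.2 (sub_pos.2 hr)).ne'
  have hpow : ∀ n : ℕ, Tendsto (fun r : ℝ => ((r : ℂ) * ζ) ^ n) (𝓝[<] 1) (𝓝 (ζ ^ n)) := fun n => by
    simpa using tendsto_radial (Polynomial.X ^ n) ζ
  rintro ⟨φ, -, hmaps, hsurj⟩
  obtain ⟨f, c, p, hf, hφ⟩ := (hmaps _ (memMbar_one hζ₁)).exists_eq hζ₂
  simp only [mul_one] at hφ
  obtain ⟨g, hg, hφg⟩ := hsurj _ (memMbar_one hζ₂)
  obtain ⟨f₁, c₁, p₁, hf₁, hg⟩ := hg.exists_eq hζ₁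
  have hφ₀ : Tendsto (fun r : ℝ => c * ((rootProd ζ₂).eval ((r : ℂ) * ζ) * f (r * ζ) /
      ((√(1 - r) : ℝ) : ℂ))) (𝓝[<] 1) (𝓝 0) := by
    simpa using (tendsto_mul_div_sqrt hA₂ζ (hf.tendsto_sqrt_mul hζ)).const_mul c
  have hg₀ : Tendsto (fun r : ℝ => ((√(1 - r) : ℝ) : ℂ) * (((r : ℂ) * ζ) ^ N₁ * g (r * ζ)))
      (𝓝[<] 1) (𝓝 0) := by
    have h := (((hf₁.tendsto_sqrt_mul hζ).mul (tendsto_radial (rootProd ζ₁) ζ)).const_mul c₁).sub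
      (tendsto_sqrt_one_sub.mul (tendsto_radial p₁ ζ))
    simp only [zero_mul, mul_zero, sub_zero] at h
    refine h.congr' ?_
    filter_upwards [eventually_mul_mem_unitDisk hζ] with r hr
    rw [hg _ hr.1]
    ring
  have hpζ : p.eval ζ ≠ 0 := fun hp => by
    have h := (hφ₀.sub (tendsto_div_sqrt hp)).mul hg₀
    rw [sub_zero, mul_zero] at h
    have hne : ζ ^ (N₂ + N₁) ≠ 0 := pow_ne_zero _ (by rw [← norm_ne_zero_iff, hζ]; exact one_ne_zero)
    refine hne (tendsto_nhds_unique (hpow _) (h.congr' ?_))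
    filter_upwards [eventually_mul_mem_unitDisk hζ] with r ⟨hz, _, hr⟩
    have h1 := hφ _ hz
    have h2 := hφg _ hz
    have h3 := hsqrt r hr
    rw [← mul_div_assoc, ← sub_div, ← h1, pow_add, div_mul_eq_mul_div, div_eq_iff h3]
    linear_combination (-((r : ℂ) * ζ) ^ N₂ * ((r : ℂ) * ζ) ^ N₁ * ((√(1 - r) : ℝ) : ℂ)) * h2
  have hφlim : Tendsto (fun r : ℝ => ((r : ℂ) * ζ) ^ N₂ * φ (r * ζ)) (𝓝[<] 1)
      (𝓝 (-p.eval ζ)) := by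
    have h := (tendsto_sqrt_one_sub.mul hφ₀).sub (tendsto_radial p ζ)
    rw [zero_mul, zero_sub] at h
    refine h.congr' ?_
    filter_upwards [eventually_mul_mem_unitDisk hζ] with r ⟨hz, _, hr⟩
    have h3 := hsqrt r hr
    rw [hφ _ hz]
    field_simp
  obtain ⟨h, hh, hnot⟩ := exists_memH2_not_tendsto hζ
  obtain ⟨f₂, c₂, p₂, hf₂, hφh⟩ := (hmaps _ (memMbar_mul hζ₁ hh)).exists_eq hζ₂
  have hdivide : ∀ z ∈ unitDisk, z ^ N₂ * φ z * h z =
      c₂ * (K.eval z * f₂ z) - p₂.eval z / (rootProd ζ₁).eval z := fun z hz => by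
    have h1 := hφh z hz
    rw [← eval_rootProd, hK, Polynomial.eval_mul] at h1
    have h2 := hA₁ z hz
    field_simp
    linear_combination h1
  have hKf := (tendsto_mul_div_sqrt hKζ (hf₂.tendsto_sqrt_mul hζ)).const_mul c₂
  rw [mul_zero] at hKf
  have hKf' : Tendsto (fun r : ℝ => c₂ * (K.eval ((r : ℂ) * ζ) * f₂ (r * ζ))) (𝓝[<] 1) (𝓝 0) := by
    have h1 := tendsto_sqrt_one_sub.mul hKf
    rw [mul_zero] at h1
    refine h1.congr' ?_
    filter_upwards [self_mem_nhdsWithin] with r hr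
    have h3 := hsqrt r hr
    field_simp
  obtain ⟨L, hL⟩ := exists_tendsto_div hζ p₂ (rootProd ζ₁) hA₁ (by
    have h1 := (tendsto_sqrt_one_sub.mul hKf').sub (hφlim.mul (hh.tendsto_sqrt_mul hζ))
    rw [mul_zero, mul_zero, sub_zero] at h1
    refine h1.congr' ?_
    filter_upwards [eventually_mul_mem_unitDisk hζ] with r hr
    linear_combination (-((√(1 - r) : ℝ) : ℂ)) * hdivide _ hr.1)
  refine hnot _ (((hKf'.sub hL).div hφlim (neg_ne_zero.2 hpζ)).congr' ?_)
  filter_upwards [eventually_mul_mem_unitDisk hζ, hφlim.eventually_ne (neg_ne_zero.2 hpζ)]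
    with r hr hne
  rw [Pi.div_apply, ← hdivide _ hr.1, mul_div_cancel_left₀ _ hne]
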